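/- arXiv:1304.3886 — 4 statements merged into one kernel-verified Lean document; each statement's English description precedes it below -/
import Mathlib

section
/- Fix integers N, M ≥ 1, a matrix H ∈ ℝ^{M×N}, σ > 0, and x₀ ∈ ℝ^N. For every n ∈ ℕ and every family x₁, …, x_n ∈ ℝ^N, the n×n real matrix R with entries R_{ij} = exp((1/σ²)·⟨H(x_i − x₀), H(x_j − x₀)⟩), where ⟨·,·⟩ is the Euclidean inner product on ℝ^M, is symmetric and positive semidefinite. (That is, the SLGM kernel R_{SLGM,x₀}(x₁,x₂) = exp((1/σ²)(x₂−x₀)ᵀHᵀH(x₁−x₀)) is a valid kernel function.) -/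
open Matrix

/-- Entrywise powers of a positive semidefinite real matrix are positive semidefinite. -/
theorem Matrix.PosSemidef.map_pow {ι : Type*} [Fintype ι] {A : Matrix ι ι ℝ}
    (hA : A.PosSemidef) (k : ℕ) : (A.map (· ^ k)).PosSemidef := by
  induction k with
  | zero =>
    convert posSemidef_vecMulVec_self_star (fun _ : ι => (1 : ℝ)) using 1
    ext i j
    simp [vecMulVec_apply]
  | succ k ih =>
    have h : A.map (· ^ (k + 1)) = A.map (· ^ k) ⊙ A := by
      ext i j
      simp [pow_succ]
    rw [h]
    exact ih.hadamard hA

/-- The entrywise exponential of a positive semidefinite real matrix is positive semidefinite. -/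
theorem Matrix.PosSemidef.map_exp {ι : Type*} [Fintype ι] {A : Matrix ι ι ℝ}
    (hA : A.PosSemidef) : (A.map Real.exp).PosSemidef := by
  refine posSemidef_iff_dotProduct_mulVec.2 ⟨hA.isHermitian.map _ fun _ => rfl, fun a => ?_⟩
  have hexp (t : ℝ) : HasSum (fun k : ℕ => (k.factorial : ℝ)⁻¹ * t ^ k) (Real.exp t) := by
    simpa [Real.exp_eq_exp_ℝ] using NormedSpace.exp_series_hasSum_exp' (𝕂 := ℝ) t
  have hsum : HasSum
      (fun k : ℕ => star a ⬝ᵥ (((k.factorial : ℝ)⁻¹ • A.map (· ^ k)) *ᵥ a))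
      (star a ⬝ᵥ (A.map Real.exp *ᵥ a)) := by
    simp only [dotProduct, mulVec, smul_apply, map_apply, smul_eq_mul]
    exact hasSum_sum fun i _ => (hasSum_sum fun j _ => (hexp (A i j)).mul_right _).mul_left _
  exact hsum.nonneg fun k =>
    ((hA.map_pow k).smul (by positivity)).dotProduct_mulVec_nonneg a

/-- The SLGM kernel
`R_{SLGM,x₀}(x₁,x₂) = exp((1/σ²)(x₂−x₀)ᵀHᵀH(x₁−x₀))` is a valid kernel function:
for every finite family `x₁,…,x_n ∈ ℝ^N`, the matrix with entries
`exp((1/σ²)⟨H(xᵢ−x₀), H(xⱼ−x₀)⟩)` is symmetric positive semidefinite. -/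
theorem slgm_kernel_posSemidef {N M : ℕ} (hN : 1 ≤ N) (hM : 1 ≤ M)
    (H : Matrix (Fin M) (Fin N) ℝ) (σ : ℝ) (hσ : 0 < σ) (x₀ : Fin N → ℝ)
    (n : ℕ) (x : Fin n → (Fin N → ℝ)) :
    (Matrix.of fun i j : Fin n =>
        Real.exp ((1 / σ ^ 2) *
          ∑ m, H.mulVec (x i - x₀) m * H.mulVec (x j - x₀) m)).PosSemidef := by
  have hA := ((posSemidef_self_mul_conjTranspose
    (Matrix.of fun i => H *ᵥ (x i - x₀))).smul (show 0 ≤ 1 / σ ^ 2 by positivity)).map_exp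
  convert hA using 1
  ext i j
  simp [mul_apply]
end

section
/- (Sparse CRB, full-support case.) Consider the SLGM and assume every set of at most S columns of H is linearly independent (spark(H) > S). Let x₀ ∈ X_S with |supp(x₀)| = S, and let ĝ : ℝ^M → ℝ be Borel measurable, P_x-integrable for every x ∈ X_S, with ∫ ĝ² dP_{x₀} < ∞; write γ(x) = ∫ ĝ dP_x for x ∈ X_S. Suppose that for each l ∈ supp(x₀) the map t ↦ γ(x₀ + t e_l) is differentiable at t = 0, with derivative b_l. Then, with K = supp(x₀) and b = (b_l)_{l∈K} ∈ ℝ^K, the matrix H_Kᵀ H_K is invertible and v(ĝ; x₀) ≥ σ² · bᵀ (H_Kᵀ H_K)^{−1} b. -/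
open Matrix MeasureTheory ProbabilityTheory

/-- The distribution `P_x` of `y = Hx + n` where `n` has i.i.d. `N(0,σ²)` entries. -/
noncomputable def slgmP {M N : ℕ} (H : Matrix (Fin M) (Fin N) ℝ) (σ : ℝ)
    (x : Fin N → ℝ) : Measure (Fin M → ℝ) :=
  Measure.map (fun n => H.mulVec x + n)
    (Measure.pi fun _ : Fin M => gaussianReal 0 ((σ ^ 2).toNNReal))

/-- The set `X_S` of `S`-sparse parameter vectors. -/
def sparseSet (N S : ℕ) : Set (Fin N → ℝ) := {x | (Function.support x).ncard ≤ S}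

/-- Mean function `γ_ĝ(x) = ∫ ĝ dP_x` of an estimator. -/
noncomputable def slgmMean {M N : ℕ} (H : Matrix (Fin M) (Fin N) ℝ) (σ : ℝ)
    (g : (Fin M → ℝ) → ℝ) (x : Fin N → ℝ) : ℝ := ∫ y, g y ∂ slgmP H σ x

/-- Variance `v(ĝ;x) = ∫ (ĝ(y) − γ_ĝ(x))² dP_x(y)` of an estimator. -/
noncomputable def slgmVar {M N : ℕ} (H : Matrix (Fin M) (Fin N) ℝ) (σ : ℝ)
    (g : (Fin M → ℝ) → ℝ) (x : Fin N → ℝ) : ℝ :=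
  ∫ y, (g y - slgmMean H σ g x) ^ 2 ∂ slgmP H σ x

/-- The submatrix `H_K` of the columns of `H` indexed by `K`. -/
def Hsub {M N : ℕ} (H : Matrix (Fin M) (Fin N) ℝ) (K : Finset (Fin N)) :
    Matrix (Fin M) ↥K ℝ := Matrix.of fun m k => H m k.1

/-- The Gram matrix `H_Kᵀ H_K`. -/
noncomputable def gramK {M N : ℕ} (H : Matrix (Fin M) (Fin N) ℝ) (K : Finset (Fin N)) :
    Matrix ↥K ↥K ℝ := (Hsub H K)ᵀ * Hsub H K

/-- The orthogonal projection matrix `P = H_K (H_Kᵀ H_K)⁻¹ H_Kᵀ`. -/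
noncomputable def projK {M N : ℕ} (H : Matrix (Fin M) (Fin N) ℝ) (K : Finset (Fin N)) :
    Matrix (Fin M) (Fin M) ℝ := Hsub H K * (gramK H K)⁻¹ * (Hsub H K)ᵀ

/-- The vector `x̃₀`: entries indexed by `K` equal `(H_Kᵀ H_K)⁻¹ H_Kᵀ (H x₀)`, other
entries are `0`; so `supp(x̃₀) ⊆ K` and `H x̃₀ = P H x₀`. -/
noncomputable def xtilde {M N : ℕ} (H : Matrix (Fin M) (Fin N) ℝ) (K : Finset (Fin N))
    (x₀ : Fin N → ℝ) : Fin N → ℝ :=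
  fun l => if h : l ∈ K then
    ((gramK H K)⁻¹ * (Hsub H K)ᵀ).mulVec (H.mulVec x₀) ⟨l, h⟩ else 0

open scoped NNReal ENNReal Topology
open Filter

/-- The density of `⊗ N(uᵢ, v)` with respect to `⊗ N(0, v)`. -/
noncomputable def gaussianShiftDensity {ι : Type*} [Fintype ι] (v : ℝ≥0) (u n : ι → ℝ) : ℝ :=
  Real.exp (u ⬝ᵥ n / v - u ⬝ᵥ u / (2 * v))

section GaussianShift

variable {ι : Type*} [Fintype ι] {v : ℝ≥0}

lemma gaussianShiftDensity_pos (u n : ι → ℝ) : 0 < gaussianShiftDensity v u n := Real.exp_pos _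

lemma measurable_gaussianShiftDensity (u : ι → ℝ) :
    Measurable (gaussianShiftDensity v u) := by
  unfold gaussianShiftDensity dotProduct
  fun_prop

lemma gaussianShiftDensity_eq_prod (u n : ι → ℝ) :
    gaussianShiftDensity v u n = ∏ i, Real.exp (u i * n i / v - u i * u i / (2 * v)) := by
  rw [← Real.exp_sum, Finset.sum_sub_distrib, ← Finset.sum_div, ← Finset.sum_div]
  rfl

lemma gaussianShiftDensity_mul (u w n : ι → ℝ) :
    gaussianShiftDensity v u n * gaussianShiftDensity v w n =
      Real.exp (u ⬝ᵥ w / v) * gaussianShiftDensity v (u + w) n := by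
  unfold gaussianShiftDensity
  rw [← Real.exp_add, ← Real.exp_add]
  congr 1
  simp only [add_dotProduct, dotProduct_add, dotProduct_comm w u]
  ring

lemma gaussianReal_eq_withDensity_gaussianReal_zero (hv : v ≠ 0) (a : ℝ) :
    gaussianReal a v = (gaussianReal 0 v).withDensity
      (fun x => ENNReal.ofReal (Real.exp (a * x / v - a * a / (2 * v)))) := by
  have hv' : (v : ℝ) ≠ 0 := by exact_mod_cast hv
  rw [gaussianReal_of_var_ne_zero a hv, gaussianReal_of_var_ne_zero 0 hv,
    ← withDensity_mul _ (by fun_prop) (by fun_prop)]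
  congr 1
  ext x
  simp only [Pi.mul_apply, gaussianPDF, gaussianPDFReal]
  rw [← ENNReal.ofReal_mul (by positivity), mul_assoc (√_)⁻¹, ← Real.exp_add]
  congr 3
  field_simp
  ring

lemma integrable_exp_shift_gaussianReal (hv : v ≠ 0) (a : ℝ) :
    Integrable (fun x => Real.exp (a * x / v - a * a / (2 * v))) (gaussianReal 0 v) := by
  refine ⟨by fun_prop, ?_⟩
  rw [hasFiniteIntegral_iff_ofReal (ae_of_all _ fun _ => (Real.exp_pos _).le),
    ← setLIntegral_univ, ← withDensity_apply _ MeasurableSet.univ,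
    ← gaussianReal_eq_withDensity_gaussianReal_zero hv]
  exact measure_lt_top _ _

lemma pi_gaussianReal_eq_withDensity (hv : v ≠ 0) (u : ι → ℝ) :
    Measure.pi (fun i => gaussianReal (u i) v) =
      (Measure.pi fun _ : ι => gaussianReal 0 v).withDensity
        (fun n => ENNReal.ofReal (gaussianShiftDensity v u n)) := by
  refine Measure.pi_eq fun s hs => ?_
  have hint (i : ι) := (integrable_exp_shift_gaussianReal hv (u i)).restrict (s := s i)
  rw [withDensity_apply _ (MeasurableSet.univ_pi hs), Measure.restrict_pi_pi]
  simp_rw [gaussianShiftDensity_eq_prod]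
  rw [← ofReal_integral_eq_lintegral_ofReal (Integrable.fintype_prod_dep hint)
      (ae_of_all _ fun _ => Finset.prod_nonneg fun _ _ => (Real.exp_pos _).le),
    integral_fintype_prod_eq_prod (μ := fun i => (gaussianReal 0 v).restrict (s i))
      (fun i x => Real.exp (u i * x / v - u i * u i / (2 * v))),
    ENNReal.ofReal_prod_of_nonneg fun i _ => integral_nonneg fun _ => (Real.exp_pos _).le]
  refine Finset.prod_congr rfl fun i _ => ?_
  rw [ofReal_integral_eq_lintegral_ofReal (hint i) (ae_of_all _ fun _ => (Real.exp_pos _).le),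
    gaussianReal_eq_withDensity_gaussianReal_zero hv (u i), withDensity_apply _ (hs i)]

lemma pi_gaussianReal_map_const_add (hv : v ≠ 0) (u : ι → ℝ) :
    (Measure.pi fun _ : ι => gaussianReal 0 v).map (fun n => u + n) =
      (Measure.pi fun _ : ι => gaussianReal 0 v).withDensity
        (fun n => ENNReal.ofReal (gaussianShiftDensity v u n)) := by
  rw [← pi_gaussianReal_eq_withDensity hv]
  have h := Measure.pi_map_pi (μ := fun _ : ι => gaussianReal 0 v)
    (f := fun i x => u i + x) (fun i => by fun_prop)
  refine Eq.trans h ?_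
  congr 1
  ext1 i
  rw [gaussianReal_map_const_add, zero_add]

lemma integral_gaussianShiftDensity_mul (hv : v ≠ 0) (u : ι → ℝ) (F : (ι → ℝ) → ℝ)
    (hF : Measurable F) :
    ∫ n, gaussianShiftDensity v u n * F n ∂(Measure.pi fun _ : ι => gaussianReal 0 v) =
      ∫ n, F (u + n) ∂(Measure.pi fun _ : ι => gaussianReal 0 v) := by
  rw [← integral_map (φ := fun n => u + n) (by fun_prop) hF.aestronglyMeasurable,
    pi_gaussianReal_map_const_add hv,
    integral_withDensity_eq_integral_toReal_smul
      (measurable_gaussianShiftDensity u).ennreal_ofReal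
      (ae_of_all _ fun _ => ENNReal.ofReal_lt_top)]
  simp only [ENNReal.toReal_ofReal (gaussianShiftDensity_pos _ _).le, smul_eq_mul]

lemma integral_gaussianShiftDensity (hv : v ≠ 0) (u : ι → ℝ) :
    ∫ n, gaussianShiftDensity v u n ∂(Measure.pi fun _ : ι => gaussianReal 0 v) = 1 := by
  simpa using integral_gaussianShiftDensity_mul hv u (fun _ => 1) measurable_const

lemma integrable_gaussianShiftDensity (hv : v ≠ 0) (u : ι → ℝ) :
    Integrable (gaussianShiftDensity v u) (Measure.pi fun _ : ι => gaussianReal 0 v) :=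
  not_imp_comm.1 integral_undef (by rw [integral_gaussianShiftDensity hv]; exact one_ne_zero)

lemma memLp_two_gaussianShiftDensity (hv : v ≠ 0) (u : ι → ℝ) :
    MemLp (gaussianShiftDensity v u) 2 (Measure.pi fun _ : ι => gaussianReal 0 v) := by
  rw [memLp_two_iff_integrable_sq (measurable_gaussianShiftDensity u).aestronglyMeasurable]
  simp_rw [sq, gaussianShiftDensity_mul]
  exact (integrable_gaussianShiftDensity hv _).const_mul _

lemma integral_gaussianShiftDensity_sub_one_mul (hv : v ≠ 0) (u w : ι → ℝ) :
    ∫ n, (gaussianShiftDensity v u n - 1) * (gaussianShiftDensity v w n - 1)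
      ∂(Measure.pi fun _ : ι => gaussianReal 0 v) = Real.exp (u ⬝ᵥ w / v) - 1 := by
  have e (n : ι → ℝ) : (gaussianShiftDensity v u n - 1) * (gaussianShiftDensity v w n - 1) =
      Real.exp (u ⬝ᵥ w / v) * gaussianShiftDensity v (u + w) n - gaussianShiftDensity v u n -
        (gaussianShiftDensity v w n - 1) := by
    rw [← gaussianShiftDensity_mul]; ring
  have h1 := integrable_gaussianShiftDensity hv u
  have h2 := integrable_gaussianShiftDensity hv w
  have h3 := (integrable_gaussianShiftDensity hv (u + w)).const_mul (Real.exp (u ⬝ᵥ w / v))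
  have h31 : Integrable (fun n => Real.exp (u ⬝ᵥ w / v) * gaussianShiftDensity v (u + w) n -
      gaussianShiftDensity v u n) (Measure.pi fun _ : ι => gaussianReal 0 v) := h3.sub h1
  have h21 : Integrable (fun n => gaussianShiftDensity v w n - 1)
      (Measure.pi fun _ : ι => gaussianReal 0 v) := h2.sub (integrable_const 1)
  simp_rw [e]
  rw [integral_sub h31 h21, integral_sub h3 h1, integral_sub h2 (integrable_const 1),
    integral_const_mul]
  simp [integral_gaussianShiftDensity hv]

end GaussianShift

lemma sq_integral_mul_le {α : Type*} [MeasurableSpace α] {μ : Measure α} {f k : α → ℝ}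
    (hf : MemLp f 2 μ) (hk : MemLp k 2 μ) :
    (∫ x, f x * k x ∂μ) ^ 2 ≤ (∫ x, f x ^ 2 ∂μ) * ∫ x, k x ^ 2 ∂μ := by
  have hfk : Integrable (fun x => f x * k x) μ := hf.integrable_mul hk
  have hsum (s : ℝ) : Integrable (fun x => s * s * f x ^ 2 + 2 * s * (f x * k x)) μ :=
    (hf.integrable_sq.const_mul _).add (hfk.const_mul _)
  have h (s : ℝ) : 0 ≤ (∫ x, f x ^ 2 ∂μ) * (s * s) + (2 * ∫ x, f x * k x ∂μ) * s +
      ∫ x, k x ^ 2 ∂μ := by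
    calc 0 ≤ ∫ x, (s * f x + k x) ^ 2 ∂μ := integral_nonneg fun _ => sq_nonneg _
      _ = ∫ x, (s * s) * f x ^ 2 + (2 * s) * (f x * k x) + k x ^ 2 ∂μ := by
        congr 1; ext x; ring
      _ = _ := by
        rw [integral_add (hsum s) hk.integrable_sq,
          integral_add (hf.integrable_sq.const_mul _) (hfk.const_mul _), integral_const_mul,
          integral_const_mul]
        ring
  have := discrim_le_zero h
  unfold discrim at this
  nlinarith

lemma tendsto_exp_sq_mul_sub_one_div (c : ℝ) :
    Tendsto (fun t : ℝ => (t ^ 2)⁻¹ * (Real.exp (t ^ 2 * c) - 1)) (𝓝[≠] 0) (𝓝 c) := by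
  have h : HasDerivAt (fun s : ℝ => Real.exp (s * c)) c 0 := by
    simpa using ((hasDerivAt_id (0 : ℝ)).mul_const c).exp
  have hsq : Tendsto (fun t : ℝ => t ^ 2) (𝓝[≠] 0) (𝓝[≠] 0) := by
    refine tendsto_nhdsWithin_iff.2 ⟨?_, ?_⟩
    · exact (Continuous.tendsto' (by fun_prop) _ _ (by simp)).mono_left nhdsWithin_le_nhds
    · filter_upwards [self_mem_nhdsWithin] with t ht
      exact pow_ne_zero 2 ht
  simpa [Function.comp_def] using h.tendsto_slope_zero.comp hsq

/-- Cramér–Rao inequality for the mean of a Gaussian vector, along finitely many directions. -/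
lemma sq_sum_mul_deriv_le_variance_mul {ι κ : Type*} [Fintype ι] [Fintype κ] {v : ℝ≥0}
    (hv : v ≠ 0) {F : (ι → ℝ) → ℝ} (hF : Measurable F)
    (hF2 : MemLp F 2 (Measure.pi fun _ : ι => gaussianReal 0 v)) (h : κ → ι → ℝ) (b a : κ → ℝ)
    (hder : ∀ k, HasDerivAt
      (fun t : ℝ => ∫ n, F (t • h k + n) ∂(Measure.pi fun _ : ι => gaussianReal 0 v)) (b k) 0) :
    (∑ k, a k * b k) ^ 2 ≤
      (∫ n, (F n - ∫ n', F n' ∂(Measure.pi fun _ : ι => gaussianReal 0 v)) ^ 2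
        ∂(Measure.pi fun _ : ι => gaussianReal 0 v)) *
      ∑ k, ∑ l, a k * a l * (h k ⬝ᵥ h l / v) := by
  set ν := Measure.pi fun _ : ι => gaussianReal 0 v
  set m := ∫ n, F n ∂ν
  let D (t : ℝ) (k : κ) (n : ι → ℝ) : ℝ := gaussianShiftDensity v (t • h k) n - 1
  let Q (t : ℝ) (n : ι → ℝ) : ℝ := ∑ k, a k * t⁻¹ * D t k n
  have hD (t : ℝ) (k : κ) : MemLp (D t k) 2 ν :=
    (memLp_two_gaussianShiftDensity hv _).sub (memLp_const 1)
  have hQ (t : ℝ) : MemLp (Q t) 2 ν := memLp_finsetSum _ fun k _ => (hD t k).const_mul _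
  have hFm : MemLp (fun n => F n - m) 2 ν := hF2.sub (memLp_const m)
  have hFD (t : ℝ) (k : κ) : ∫ n, (F n - m) * D t k n ∂ν = (∫ n, F (t • h k + n) ∂ν) - m := by
    have hL := memLp_two_gaussianShiftDensity hv (t • h k)
    have hLF : Integrable (fun n => gaussianShiftDensity v (t • h k) n * F n) ν :=
      hL.integrable_mul hF2
    have hLi := integrable_gaussianShiftDensity hv (t • h k)
    have hFi : Integrable F ν := hF2.integrable one_le_two
    have e (n : ι → ℝ) : (F n - m) * D t k n = gaussianShiftDensity v (t • h k) n * F n -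
        m * gaussianShiftDensity v (t • h k) n - (F n - m) := by
      simp only [D]; ring
    have hLFm : Integrable (fun n => gaussianShiftDensity v (t • h k) n * F n -
        m * gaussianShiftDensity v (t • h k) n) ν := hLF.sub (hLi.const_mul m)
    simp_rw [e]
    rw [integral_sub hLFm (hFm.integrable one_le_two), integral_sub hLF (hLi.const_mul m),
      integral_sub hFi (integrable_const m), integral_const_mul, integral_gaussianShiftDensity hv,
      integral_gaussianShiftDensity_mul hv _ F hF]
    simp [m, ν]
  have hFQ (t : ℝ) : ∫ n, (F n - m) * Q t n ∂ν =
      ∑ k, a k * (t⁻¹ * ((∫ n, F (t • h k + n) ∂ν) - m)) := by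
    have e (n : ι → ℝ) : (F n - m) * Q t n = ∑ k, a k * t⁻¹ * ((F n - m) * D t k n) := by
      simp only [Q, Finset.mul_sum]
      exact Finset.sum_congr rfl fun _ _ => by ring
    have hi (k : κ) : Integrable (fun n => a k * t⁻¹ * ((F n - m) * D t k n)) ν :=
      (hFm.integrable_mul (hD t k)).const_mul _
    simp_rw [e]
    rw [integral_finsetSum _ fun k _ => hi k]
    refine Finset.sum_congr rfl fun k _ => ?_
    rw [integral_const_mul, hFD, mul_assoc]
  have hQQ (t : ℝ) : ∫ n, Q t n ^ 2 ∂ν =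
      ∑ k, ∑ l, a k * a l * ((t ^ 2)⁻¹ * (Real.exp (t ^ 2 * (h k ⬝ᵥ h l / v)) - 1)) := by
    have e (n : ι → ℝ) : Q t n ^ 2 =
        ∑ k, ∑ l, a k * a l * (t ^ 2)⁻¹ * (D t k n * D t l n) := by
      simp only [Q, sq (∑ k, _), Finset.sum_mul_sum]
      exact Finset.sum_congr rfl fun _ _ => Finset.sum_congr rfl fun _ _ => by ring
    have hi (k l : κ) : Integrable (fun n => a k * a l * (t ^ 2)⁻¹ * (D t k n * D t l n)) ν :=
      ((hD t k).integrable_mul (hD t l)).const_mul _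
    simp_rw [e]
    rw [integral_finsetSum _ fun k _ => integrable_finsetSum _ fun l _ => hi k l]
    refine Finset.sum_congr rfl fun k _ => ?_
    rw [integral_finsetSum _ fun l _ => hi k l]
    refine Finset.sum_congr rfl fun l _ => ?_
    rw [integral_const_mul, integral_gaussianShiftDensity_sub_one_mul hv, mul_assoc]
    simp only [smul_dotProduct, dotProduct_smul, smul_eq_mul]
    congr 4
    ring
  have lim1 : Tendsto (fun t : ℝ => (∫ n, (F n - m) * Q t n ∂ν) ^ 2) (𝓝[≠] 0)
      (𝓝 ((∑ k, a k * b k) ^ 2)) := by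
    simp_rw [hFQ]
    refine (tendsto_finsetSum _ fun k _ => Tendsto.const_mul _ ?_).pow 2
    simpa [m] using (hder k).tendsto_slope_zero
  have lim2 : Tendsto (fun t : ℝ => (∫ n, (F n - m) ^ 2 ∂ν) * ∫ n, Q t n ^ 2 ∂ν) (𝓝[≠] 0)
      (𝓝 ((∫ n, (F n - m) ^ 2 ∂ν) * ∑ k, ∑ l, a k * a l * (h k ⬝ᵥ h l / v))) := by
    simp_rw [hQQ]
    exact (tendsto_finsetSum _ fun k _ => tendsto_finsetSum _ fun l _ =>
      (tendsto_exp_sq_mul_sub_one_div _).const_mul _).const_mul _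
  exact le_of_tendsto_of_tendsto' lim1 lim2 fun t => sq_integral_mul_le hFm (hQ t)

lemma isUnit_det_gramK {M N : ℕ} {H : Matrix (Fin M) (Fin N) ℝ} {K : Finset (Fin N)}
    (hK : LinearIndependent ℝ (fun k : ↥K => fun m => H m k.1)) :
    IsUnit (gramK H K).det := by
  have hinj : Function.Injective (Hsub H K).mulVec := Matrix.mulVec_injective_iff.2 hK
  have h := Matrix.PosDef.conjTranspose_mul_self (Hsub H K) hinj
  rw [Matrix.conjTranspose_eq_transpose_of_trivial] at h
  exact h.det_pos.ne'.isUnit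

/-- Sparse CRB, full-support case. If every set of at most `S`
columns of `H` is linearly independent, `|supp(x₀)| = S`, and the mean function of a
finite-variance estimator `ĝ` has partial derivatives `b_l` at `x₀` along the directions
`e_l`, `l ∈ K = supp(x₀)`, then `H_Kᵀ H_K` is invertible and
`v(ĝ;x₀) ≥ σ² bᵀ (H_Kᵀ H_K)⁻¹ b`. -/
theorem sparse_crb_full_support {N M S : ℕ} (hN : 1 ≤ N) (hM : 1 ≤ M)
    (hS1 : 1 ≤ S) (hSN : S ≤ N)
    (H : Matrix (Fin M) (Fin N) ℝ) (σ : ℝ) (hσ : 0 < σ)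
    (hspark : ∀ K : Finset (Fin N), K.card ≤ S →
      LinearIndependent ℝ (fun k : ↥K => fun m => H m k.1))
    (x₀ : Fin N → ℝ) (hx₀S : (Function.support x₀).ncard = S)
    (K : Finset (Fin N)) (hK : ∀ l, l ∈ K ↔ x₀ l ≠ 0)
    (g : (Fin M → ℝ) → ℝ) (hg : Measurable g)
    (hint : ∀ x ∈ sparseSet N S, Integrable g (slgmP H σ x))
    (hsq : Integrable (fun y => g y ^ 2) (slgmP H σ x₀))
    (b : Fin N → ℝ)
    (hder : ∀ l ∈ K, HasDerivAt
      (fun t : ℝ => slgmMean H σ g (x₀ + t • (Pi.single l (1:ℝ) : Fin N → ℝ))) (b l) 0) :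
    IsUnit (gramK H K).det ∧
    σ ^ 2 * ∑ k : ↥K, ∑ l : ↥K, b k.1 * (gramK H K)⁻¹ k l * b l.1
      ≤ slgmVar H σ g x₀ := by
  have hKS : K.card ≤ S := by
    rw [← hx₀S, ← Set.ncard_coe_finset]
    exact Set.ncard_le_ncard (fun l hl => (hK l).1 hl) (Set.toFinite _)
  have hdet := isUnit_det_gramK (hspark K hKS)
  refine ⟨hdet, ?_⟩
  set v : ℝ≥0 := (σ ^ 2).toNNReal
  have hvσ : (v : ℝ) = σ ^ 2 := Real.coe_toNNReal _ (sq_nonneg σ)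
  have hv : v ≠ 0 := fun h => by
    rw [h] at hvσ
    exact (pow_pos hσ 2).ne hvσ
  set ν := Measure.pi fun _ : Fin M => gaussianReal 0 v
  let F (n : Fin M → ℝ) : ℝ := g (H.mulVec x₀ + n)
  have hF : Measurable F := hg.comp (by fun_prop)
  have hF2 : MemLp F 2 ν :=
    (memLp_two_iff_integrable_sq hF.aestronglyMeasurable).2 (hsq.comp_measurable (by fun_prop))
  have hmean (x : Fin N → ℝ) : slgmMean H σ g x = ∫ n, g (H.mulVec x + n) ∂ν :=
    integral_map (by fun_prop) hg.aestronglyMeasurable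
  have hvar : slgmVar H σ g x₀ = ∫ n, (F n - ∫ n', F n' ∂ν) ^ 2 ∂ν := by
    unfold slgmVar
    rw [hmean]
    exact integral_map (by fun_prop) (by fun_prop)
  have hcrb := sq_sum_mul_deriv_le_variance_mul hv hF hF2 (fun (k : ↥K) m => H m k.1)
    (fun k => b k.1) ((gramK H K)⁻¹ *ᵥ fun k => b k.1) fun k => by
      convert hder k.1 k.2 using 2 with t
      rw [hmean, Matrix.mulVec_add, Matrix.mulVec_smul, Matrix.mulVec_single_one]
      congr 1
      ext n
      simp only [F, add_assoc]
      rfl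
  set β : ↥K → ℝ := fun k => b k.1
  set a := (gramK H K)⁻¹ *ᵥ β
  have hquad : ∑ k, ∑ l, a k * a l * ((fun m => H m k.1) ⬝ᵥ (fun m => H m l.1) / v) =
      (∑ k, a k * β k) / v := by
    have hGa : gramK H K *ᵥ a = β := by
      rw [Matrix.mulVec_mulVec, Matrix.mul_nonsing_inv _ hdet, Matrix.one_mulVec]
    rw [Finset.sum_div]
    refine Finset.sum_congr rfl fun k _ => ?_
    rw [← congrFun hGa k]
    simp only [Matrix.mulVec, dotProduct, Finset.mul_sum, Finset.sum_div]
    refine Finset.sum_congr rfl fun l _ => ?_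
    simp only [gramK, Matrix.mul_apply, Matrix.transpose_apply, Hsub, Matrix.of_apply]
    rw [mul_comm (∑ _, _) (a l), ← mul_assoc, mul_div_assoc, Finset.sum_div, Finset.mul_sum]
  have hsum : ∑ k : ↥K, ∑ l : ↥K, b k.1 * (gramK H K)⁻¹ k l * b l.1 = ∑ k, a k * β k := by
    refine Finset.sum_congr rfl fun k _ => ?_
    simp only [a, β, Matrix.mulVec, dotProduct, Finset.sum_mul]
    exact Finset.sum_congr rfl fun _ _ => by ring
  rw [hquad, ← hvar, hvσ] at hcrb
  rw [hsum]
  have hvar0 : 0 ≤ slgmVar H σ g x₀ := integral_nonneg fun _ => sq_nonneg _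
  have hσ2 : 0 < σ ^ 2 := pow_pos hσ 2
  rcases le_or_gt (∑ k, a k * β k) 0 with hq | hq
  · exact (mul_nonpos_of_nonneg_of_nonpos hσ2.le hq).trans hvar0
  · rw [← mul_div_assoc, le_div_iff₀ hσ2] at hcrb
    refine le_of_mul_le_mul_right ?_ hq
    linarith
end

section
/- (RIP-based variance bound.) Consider the SLGM with M ≤ N and assume H satisfies the restricted isometry property of order S with constant δ < 1: for every I ⊆ {1,…,N} with |I| = S and every z ∈ ℝ^I, (1−δ)‖z‖₂² ≤ ‖H_I z‖₂² ≤ (1+δ)‖z‖₂². Let x₀ ∈ X_S and let K ⊆ {1,…,N} be nonempty with |K| ≤ S; then H_Kᵀ H_K is invertible. Define the vector x̃₀ ∈ ℝ^N whose entries indexed by K are given by (H_Kᵀ H_K)^{−1} H_Kᵀ (H x₀) and whose other entries are 0. Let ĝ : ℝ^M → ℝ be Borel measurable, P_x-integrable for every x ∈ X_S, with ∫ ĝ² dP_{x₀} < ∞; write γ(x) = ∫ ĝ dP_x for x ∈ X_S. Suppose that for each l ∈ K the map t ↦ γ(x̃₀ + t e_l) is differentiable at t = 0, with derivative b_l; set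 b = (b_l)_{l∈K} ∈ ℝ^K. Then v(ĝ; x₀) ≥ exp(−((1+δ)/σ²) · Σ_{l ∈ supp(x₀)∖K} (x₀)_l²) · σ² · bᵀ (H_Kᵀ H_K)^{−1} b. -/
open Matrix MeasureTheory ProbabilityTheory

open scoped ENNReal NNReal

lemma gaussianReal_zero_withDensity_exp {v : ℝ≥0} (hv : v ≠ 0) (a : ℝ) :
    (gaussianReal 0 v).withDensity
      (fun x => ENNReal.ofReal (Real.exp (a * x / v - a * a / (2 * v)))) = gaussianReal a v := by
  rw [gaussianReal_of_var_ne_zero _ hv, gaussianReal_of_var_ne_zero _ hv,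
    ← withDensity_mul _ (measurable_gaussianPDF _ _) (by fun_prop)]
  congr 1
  ext x
  have hv' : (v : ℝ) ≠ 0 := by exact_mod_cast hv
  rw [Pi.mul_apply, gaussianPDF, gaussianPDF, ← ENNReal.ofReal_mul (gaussianPDFReal_nonneg _ _ _),
    gaussianPDFReal, gaussianPDFReal, mul_assoc, ← Real.exp_add]
  congr 4
  field_simp
  ring

lemma pi_withDensity_prod {ι : Type*} [Fintype ι] {X : ι → Type*} [∀ i, MeasurableSpace (X i)]
    (μ : ∀ i, Measure (X i)) [∀ i, IsProbabilityMeasure (μ i)] {f : ∀ i, X i → ℝ≥0∞}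
    (hf : ∀ i, Measurable (f i)) [∀ i, SigmaFinite ((μ i).withDensity (f i))] :
    (Measure.pi μ).withDensity (fun x => ∏ i, f i (x i))
      = Measure.pi fun i => (μ i).withDensity (f i) := by
  symm
  refine Measure.pi_eq fun s hs => ?_
  rw [withDensity_apply _ (MeasurableSet.univ_pi hs),
    ← lintegral_indicator (MeasurableSet.univ_pi hs)]
  have hind : ∀ x : ∀ i, X i, (Set.univ.pi s).indicator (fun x => ∏ i, f i (x i)) x
      = ∏ i, (s i).indicator (f i) (x i) := by
    intro x
    by_cases hx : x ∈ Set.univ.pi s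
    · rw [Set.indicator_of_mem hx]
      exact Finset.prod_congr rfl fun i _ => (Set.indicator_of_mem (hx i trivial) _).symm
    · rw [Set.indicator_of_notMem hx]
      obtain ⟨i, hi⟩ : ∃ i, x i ∉ s i := by simpa [Set.mem_pi] using hx
      exact (Finset.prod_eq_zero (Finset.mem_univ i) (Set.indicator_of_notMem hi _)).symm
  have hm : ∀ i, Measurable ((s i).indicator (f i)) := fun i => (hf i).indicator (hs i)
  simp_rw [hind]
  rw [lintegral_prod_eq_prod_lintegral_of_indepFun Finset.univ
    (fun i (x : ∀ i, X i) => (s i).indicator (f i) (x i))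
    (iIndepFun_pi fun i => (hm i).aemeasurable)
    fun i => (hm i).comp (measurable_pi_apply i)]
  refine Finset.prod_congr rfl fun i _ => ?_
  rw [(measurePreserving_eval μ i).lintegral_comp (hm i), lintegral_indicator (hs i),
    withDensity_apply _ (hs i)]

/-- The density of `N(s, v I)` with respect to `N(0, v I)`. -/
noncomputable def shiftDensity {ι : Type*} [Fintype ι] (v : ℝ≥0) (s n : ι → ℝ) : ℝ :=
  Real.exp (s ⬝ᵥ n / v - s ⬝ᵥ s / (2 * v))

section
variable {ι : Type*} [Fintype ι] {v : ℝ≥0}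

lemma measurable_shiftDensity (s : ι → ℝ) : Measurable (shiftDensity v s) := by
  unfold shiftDensity dotProduct
  fun_prop

lemma pi_gaussianReal_map_add (hv : v ≠ 0) (s : ι → ℝ) :
    (Measure.pi fun _ : ι => gaussianReal 0 v).map (s + ·)
      = (Measure.pi fun _ : ι => gaussianReal 0 v).withDensity
          (fun n => ENNReal.ofReal (shiftDensity v s n)) := by
  have hshift : ∀ n : ι → ℝ, ENNReal.ofReal (shiftDensity v s n)
      = ∏ i, ENNReal.ofReal (Real.exp (s i * n i / v - s i * s i / (2 * v))) := by
    intro n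
    rw [← ENNReal.ofReal_prod_of_nonneg fun _ _ => (Real.exp_pos _).le, ← Real.exp_sum,
      Finset.sum_sub_distrib, ← Finset.sum_div, ← Finset.sum_div]
    rfl
  simp_rw [hshift]
  have : ∀ i, SigmaFinite ((gaussianReal 0 v).withDensity
      (fun x => ENNReal.ofReal (Real.exp (s i * x / v - s i * s i / (2 * v))))) := fun i => by
    rw [gaussianReal_zero_withDensity_exp hv]; infer_instance
  rw [pi_withDensity_prod _
    (f := fun i x => ENNReal.ofReal (Real.exp (s i * x / v - s i * s i / (2 * v))))
    fun i => by fun_prop]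
  simp_rw [gaussianReal_zero_withDensity_exp hv]
  have := Measure.pi_map_pi (μ := fun _ : ι => gaussianReal 0 v) (f := fun i x => s i + x)
    fun i => by fun_prop
  simp only [gaussianReal_map_const_add, zero_add] at this
  exact this

lemma integral_comp_add_pi_gaussianReal (hv : v ≠ 0) (s : ι → ℝ) {F : (ι → ℝ) → ℝ}
    (hF : Measurable F) :
    ∫ n, F (s + n) ∂(Measure.pi fun _ : ι => gaussianReal 0 v)
      = ∫ n, F n * shiftDensity v s n ∂(Measure.pi fun _ : ι => gaussianReal 0 v) := by
  rw [← integral_map (φ := (s + ·)) (by fun_prop) hF.aestronglyMeasurable,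
    pi_gaussianReal_map_add hv, integral_withDensity_eq_integral_toReal_smul
      (measurable_shiftDensity s).ennreal_ofReal (by simp)]
  refine integral_congr_ae (.of_forall fun n => ?_)
  simp [ENNReal.toReal_ofReal (Real.exp_pos _).le, shiftDensity, mul_comm]

lemma integral_shiftDensity (hv : v ≠ 0) (s : ι → ℝ) :
    ∫ n, shiftDensity v s n ∂(Measure.pi fun _ : ι => gaussianReal 0 v) = 1 := by
  simpa using (integral_comp_add_pi_gaussianReal hv s (F := fun _ => 1) measurable_const).symm

lemma integrable_shiftDensity (hv : v ≠ 0) (s : ι → ℝ) :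
    Integrable (shiftDensity v s) (Measure.pi fun _ : ι => gaussianReal 0 v) :=
  .of_integral_ne_zero (by simp [integral_shiftDensity hv])

lemma shiftDensity_mul (s t n : ι → ℝ) :
    shiftDensity v s n * shiftDensity v t n
      = Real.exp (s ⬝ᵥ t / v) * shiftDensity v (s + t) n := by
  rw [shiftDensity, shiftDensity, shiftDensity, ← Real.exp_add, ← Real.exp_add]
  simp only [add_dotProduct, dotProduct_add, dotProduct_comm t s]
  congr 1
  ring

lemma integral_shiftDensity_mul (hv : v ≠ 0) (s t : ι → ℝ) :
    ∫ n, shiftDensity v s n * shiftDensity v t n ∂(Measure.pi fun _ : ι => gaussianReal 0 v)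
      = Real.exp (s ⬝ᵥ t / v) := by
  simp_rw [shiftDensity_mul, integral_const_mul, integral_shiftDensity hv, mul_one]

lemma memLp_shiftDensity (hv : v ≠ 0) (s : ι → ℝ) :
    MemLp (shiftDensity v s) 2 (Measure.pi fun _ : ι => gaussianReal 0 v) := by
  rw [memLp_two_iff_integrable_sq (measurable_shiftDensity s).aestronglyMeasurable]
  simp_rw [pow_two, shiftDensity_mul]
  exact (integrable_shiftDensity hv _).const_mul _
lemma tendsto_exp_mul_sq_sub_one_div_sq (a : ℝ) :
    Filter.Tendsto (fun t : ℝ => (t⁻¹) ^ 2 * (Real.exp (t ^ 2 * a) - 1))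
      (nhdsWithin 0 {0}ᶜ) (nhds a) := by
  have h : HasDerivAt (fun x : ℝ => Real.exp (x * a)) a 0 := by
    simpa using ((hasDerivAt_id (0 : ℝ)).mul_const a).exp
  have hsq : Filter.Tendsto (fun t : ℝ => t ^ 2) (nhdsWithin 0 {0}ᶜ) (nhdsWithin 0 {0}ᶜ) := by
    refine tendsto_nhdsWithin_iff.2 ⟨?_, ?_⟩
    · exact ((continuous_pow 2).tendsto' (0 : ℝ) 0 (by simp)).mono_left nhdsWithin_le_nhds
    · filter_upwards [self_mem_nhdsWithin] with t ht
      simpa using ht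
  refine (h.tendsto_slope_zero.comp hsq).congr fun t => ?_
  simp

lemma integral_sub_sub_sub {α : Type*} [MeasurableSpace α] {μ : Measure α} {f₁ f₂ f₃ f₄ : α → ℝ}
    (h₁ : Integrable f₁ μ) (h₂ : Integrable f₂ μ) (h₃ : Integrable f₃ μ) (h₄ : Integrable f₄ μ) :
    ∫ x, ((f₁ x - f₂ x) - (f₃ x - f₄ x)) ∂μ
      = (∫ x, f₁ x ∂μ - ∫ x, f₂ x ∂μ) - (∫ x, f₃ x ∂μ - ∫ x, f₄ x ∂μ) :=
  (integral_sub (h₁.sub h₂) (h₃.sub h₄)).trans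
    (congrArg₂ (· - ·) (integral_sub h₁ h₂) (integral_sub h₃ h₄))

/-- A Hammersley–Chapman–Robbins bound in the limit of small shifts. -/
lemma two_mul_sum_sub_le_integral_sq (hv : v ≠ 0) {κ : Type*} [Fintype κ] {F : (ι → ℝ) → ℝ}
    (hF : MemLp F 2 (Measure.pi fun _ : ι => gaussianReal 0 v)) (m : ℝ)
    (s : ι → ℝ) (u : κ → ι → ℝ) (hsu : ∀ k, s ⬝ᵥ u k = 0) (b c : κ → ℝ)
    (hb : ∀ k, HasDerivAt (fun t : ℝ => ∫ n, F n * shiftDensity v (s + t • u k) n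
      ∂(Measure.pi fun _ : ι => gaussianReal 0 v)) (b k) 0) :
    2 * ∑ k, c k * b k
        - Real.exp (s ⬝ᵥ s / v) * ∑ k, ∑ l, c k * c l * (u k ⬝ᵥ u l / v)
      ≤ ∫ n, (F n - m) ^ 2 ∂(Measure.pi fun _ : ι => gaussianReal 0 v) := by
  set π := Measure.pi fun _ : ι => gaussianReal 0 v
  set E := Real.exp (s ⬝ᵥ s / v)
  have hFm : MemLp (fun n => F n - m) 2 π := hF.sub (memLp_const m)
  set D : κ → ℝ → (ι → ℝ) → ℝ :=
    fun k t n => shiftDensity v (s + t • u k) n - shiftDensity v s n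
  have hD : ∀ k t, MemLp (D k t) 2 π := fun k t =>
    (memLp_shiftDensity hv _).sub (memLp_shiftDensity hv _)
  have hcross : ∀ k t, ∫ n, (F n - m) * D k t n ∂π
      = ∫ n, F n * shiftDensity v (s + t • u k) n ∂π - ∫ n, F n * shiftDensity v s n ∂π := by
    intro k t
    have h1 := hF.integrable_mul (memLp_shiftDensity hv (s + t • u k))
    have h2 := hF.integrable_mul (memLp_shiftDensity hv s)
    have h3 := (integrable_shiftDensity hv (s + t • u k)).const_mul m
    have h4 := (integrable_shiftDensity hv s).const_mul m
    calc ∫ n, (F n - m) * D k t n ∂π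
        = ∫ n, ((F n * shiftDensity v (s + t • u k) n - F n * shiftDensity v s n)
            - (m * shiftDensity v (s + t • u k) n - m * shiftDensity v s n)) ∂π := by
          congr 1; ext n; simp only [D]; ring
      _ = _ := by
          refine (integral_sub_sub_sub h1 h2 h3 h4).trans ?_
          rw [integral_const_mul, integral_const_mul, integral_shiftDensity hv,
            integral_shiftDensity hv, sub_self, sub_zero]
          rfl
  have hgram : ∀ k l t, ∫ n, D k t n * D l t n ∂π
      = E * (Real.exp (t ^ 2 * (u k ⬝ᵥ u l / v)) - 1) := by
    intro k l t
    have hI : ∀ a b : ι → ℝ, Integrable (fun n => shiftDensity v a n * shiftDensity v b n) π :=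
      fun a b => (memLp_shiftDensity hv a).integrable_mul (memLp_shiftDensity hv b)
    have hexp : (s + t • u k) ⬝ᵥ (s + t • u l) / v
        = s ⬝ᵥ s / v + t ^ 2 * (u k ⬝ᵥ u l / v) := by
      simp only [add_dotProduct, dotProduct_add, smul_dotProduct, dotProduct_smul, hsu,
        dotProduct_comm (u k) s, smul_eq_mul]
      ring
    calc ∫ n, D k t n * D l t n ∂π
        = ∫ n, ((shiftDensity v (s + t • u k) n * shiftDensity v (s + t • u l) n
              - shiftDensity v (s + t • u k) n * shiftDensity v s n)
            - (shiftDensity v s n * shiftDensity v (s + t • u l) n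
              - shiftDensity v s n * shiftDensity v s n)) ∂π := by
          congr 1; ext n; simp only [D]; ring
      _ = _ := by
          rw [integral_sub_sub_sub (hI _ _) (hI _ _) (hI _ _) (hI _ _)]
          rw [integral_shiftDensity_mul hv, integral_shiftDensity_mul hv,
            integral_shiftDensity_mul hv, integral_shiftDensity_mul hv, hexp, Real.exp_add]
          simp only [add_dotProduct, dotProduct_add, smul_dotProduct, dotProduct_smul, hsu,
            dotProduct_comm (u k) s, smul_zero, add_zero]
          ring
  have hfin : ∀ t : ℝ, 2 * ∑ k, c k * (t⁻¹ • (∫ n, F n * shiftDensity v (s + (0 + t) • u k) n ∂π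
        - ∫ n, F n * shiftDensity v (s + (0 : ℝ) • u k) n ∂π))
      - E * ∑ k, ∑ l, c k * c l * ((t⁻¹) ^ 2 * (Real.exp (t ^ 2 * (u k ⬝ᵥ u l / v)) - 1))
      ≤ ∫ n, (F n - m) ^ 2 ∂π := by
    intro t
    set W : (ι → ℝ) → ℝ := fun n => ∑ k, c k * t⁻¹ * D k t n
    have hW : MemLp W 2 π := memLp_finsetSum _ fun k _ => (hD k t).const_mul _
    have hFW : ∫ n, (F n - m) * W n ∂π = ∑ k, c k * (t⁻¹ • (∫ n, F n *
        shiftDensity v (s + (0 + t) • u k) n ∂π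
        - ∫ n, F n * shiftDensity v (s + (0 : ℝ) • u k) n ∂π)) := by
      simp only [W, Finset.mul_sum]
      have hI : ∀ k, Integrable (fun n => (F n - m) * (c k * t⁻¹ * D k t n)) π :=
        fun k => hFm.integrable_mul ((hD k t).const_mul _)
      rw [integral_finsetSum _ fun k _ => hI k]
      refine Finset.sum_congr rfl fun k _ => ?_
      simp only [mul_left_comm _ (c k * t⁻¹) _]
      rw [integral_const_mul, hcross, zero_add, zero_smul, add_zero, smul_eq_mul, mul_assoc]
    have hWW : ∫ n, W n * W n ∂π = E * ∑ k, ∑ l, c k * c l *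
        ((t⁻¹) ^ 2 * (Real.exp (t ^ 2 * (u k ⬝ᵥ u l / v)) - 1)) := by
      simp only [W, Finset.sum_mul_sum]
      have hI : ∀ k l, Integrable (fun n => c k * t⁻¹ * D k t n * (c l * t⁻¹ * D l t n)) π :=
        fun k l => ((hD k t).const_mul _).integrable_mul ((hD l t).const_mul _)
      rw [integral_finsetSum _ fun k _ => integrable_finsetSum _ fun l _ => hI k l,
        Finset.mul_sum]
      refine Finset.sum_congr rfl fun k _ => ?_
      rw [integral_finsetSum _ fun l _ => hI k l, Finset.mul_sum]
      refine Finset.sum_congr rfl fun l _ => ?_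
      simp only [mul_mul_mul_comm _ (D k t _), integral_const_mul, hgram]
      ring
    have hnn : 0 ≤ ∫ n, ((F n - m) - W n) ^ 2 ∂π := integral_nonneg fun n => sq_nonneg _
    have hexpand : ∫ n, ((F n - m) - W n) ^ 2 ∂π
        = ∫ n, (F n - m) ^ 2 ∂π - 2 * ∫ n, (F n - m) * W n ∂π + ∫ n, W n * W n ∂π := by
      have h1 := hFm.integrable_sq
      have h2 := (hFm.integrable_mul hW).const_mul 2
      have h3 := hW.integrable_mul hW
      rw [← integral_const_mul]
      refine Eq.trans ?_ ((integral_add (h1.sub h2) h3).trans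
        (congrArg (· + _) (integral_sub h1 h2)))
      congr 1; ext n; simp only [Pi.sub_apply, Pi.mul_apply]; ring
    rw [← hFW, ← hWW]
    linarith
  refine le_of_tendsto (f := fun t : ℝ => 2 * ∑ k, c k * (t⁻¹ •
        (∫ n, F n * shiftDensity v (s + (0 + t) • u k) n ∂π
        - ∫ n, F n * shiftDensity v (s + (0 : ℝ) • u k) n ∂π))
      - E * ∑ k, ∑ l, c k * c l * ((t⁻¹) ^ 2 * (Real.exp (t ^ 2 * (u k ⬝ᵥ u l / v)) - 1)))
    (x := nhdsWithin 0 {0}ᶜ) ?_ (.of_forall hfin)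
  exact ((tendsto_finsetSum _ fun k _ => (hb k).tendsto_slope_zero.const_mul _).const_mul _).sub
    ((tendsto_finsetSum _ fun k _ => tendsto_finsetSum _ fun l _ =>
      (tendsto_exp_mul_sq_sub_one_div_sq _).const_mul _).const_mul _)

end

section
variable {M N : ℕ} (H : Matrix (Fin M) (Fin N) ℝ) (K : Finset (Fin N))

lemma Hsub_mulVec_restrict {z : Fin N → ℝ} (hz : ∀ l ∉ K, z l = 0) :
    Hsub H K *ᵥ (fun k => z k) = H *ᵥ z := by
  ext m
  simp only [mulVec, dotProduct, Hsub, of_apply]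
  rw [Finset.sum_coe_sort K fun l => H m l * z l]
  exact Finset.sum_subset K.subset_univ fun l _ hl => by simp [hz l hl]

lemma rip_of_card_le {S : ℕ} (hSN : S ≤ N) {δ : ℝ}
    (hRIP : ∀ I : Finset (Fin N), I.card = S → ∀ z : ↥I → ℝ,
      (1 - δ) * ∑ i, z i ^ 2 ≤ ∑ m, ((Hsub H I).mulVec z) m ^ 2 ∧
      ∑ m, ((Hsub H I).mulVec z) m ^ 2 ≤ (1 + δ) * ∑ i, z i ^ 2)
    (hK : K.card ≤ S) {z : Fin N → ℝ} (hz : ∀ l ∉ K, z l = 0) :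
    (1 - δ) * ∑ l, z l ^ 2 ≤ (H *ᵥ z) ⬝ᵥ (H *ᵥ z) ∧
      (H *ᵥ z) ⬝ᵥ (H *ᵥ z) ≤ (1 + δ) * ∑ l, z l ^ 2 := by
  obtain ⟨I, hKI, hI⟩ := Finset.exists_superset_card_eq hK (by simpa using hSN)
  have hzI : ∀ l ∉ I, z l = 0 := fun l hl => hz l fun h => hl (hKI h)
  have h := hRIP I hI fun k => z k
  have hsum : ∑ i : I, z i ^ 2 = ∑ l, z l ^ 2 := by
    rw [Finset.sum_coe_sort I fun l => z l ^ 2]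
    exact Finset.sum_subset I.subset_univ fun l _ hl => by simp [hzI l hl]
  rw [Hsub_mulVec_restrict H I hzI, hsum] at h
  simpa only [dotProduct, ← pow_two] using h

/-- Extension of a vector indexed by `K` by zero. -/
def extendZero {K : Finset (Fin N)} (c : ↥K → ℝ) : Fin N → ℝ :=
  fun l => if h : l ∈ K then c ⟨l, h⟩ else 0

variable {K}

lemma extendZero_of_notMem (c : ↥K → ℝ) {l : Fin N} (hl : l ∉ K) : extendZero c l = 0 := by
  simp [extendZero, hl]

lemma mulVec_extendZero (c : ↥K → ℝ) : H *ᵥ extendZero c = Hsub H K *ᵥ c := by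
  rw [← Hsub_mulVec_restrict H K fun l hl => extendZero_of_notMem c hl]
  congr 1
  ext k
  simp [extendZero]

lemma isUnit_det_gramK_s7 {S : ℕ} (hSN : S ≤ N) {δ : ℝ} (hδ : δ < 1)
    (hRIP : ∀ I : Finset (Fin N), I.card = S → ∀ z : ↥I → ℝ,
      (1 - δ) * ∑ i, z i ^ 2 ≤ ∑ m, ((Hsub H I).mulVec z) m ^ 2 ∧
      ∑ m, ((Hsub H I).mulVec z) m ^ 2 ≤ (1 + δ) * ∑ i, z i ^ 2)
    (hK : K.card ≤ S) : IsUnit (gramK H K).det := by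
  rw [isUnit_iff_ne_zero]
  intro h0
  obtain ⟨c, hc, hGc⟩ := exists_mulVec_eq_zero_iff.2 h0
  have hHc : (Hsub H K *ᵥ c) ⬝ᵥ (Hsub H K *ᵥ c) = 0 := by
    rw [dotProduct_mulVec, ← mulVec_transpose, mulVec_mulVec]
    simp only [gramK] at hGc
    simp [hGc]
  have h := (rip_of_card_le H K hSN hRIP hK fun l hl => extendZero_of_notMem c hl).1
  rw [mulVec_extendZero, hHc] at h
  have hsum : ∑ l, extendZero c l ^ 2 = 0 :=
    le_antisymm (nonpos_of_mul_nonpos_right h (by linarith))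
      (Finset.sum_nonneg fun _ _ => sq_nonneg _)
  refine hc (funext fun k => ?_)
  have := (Finset.sum_eq_zero_iff_of_nonneg fun _ _ => sq_nonneg _).1 hsum k (Finset.mem_univ _)
  simpa [extendZero] using this

lemma mulVec_xtilde_sub_dotProduct_col (hdet : IsUnit (gramK H K).det) (x : Fin N → ℝ)
    (c : ↥K → ℝ) : (H *ᵥ xtilde H K x - H *ᵥ x) ⬝ᵥ (Hsub H K *ᵥ c) = 0 := by
  have hx : H *ᵥ xtilde H K x
      = Hsub H K *ᵥ (((gramK H K)⁻¹ * (Hsub H K)ᵀ) *ᵥ (H *ᵥ x)) := mulVec_extendZero H _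
  have hz : (Hsub H K)ᵀ *ᵥ (H *ᵥ xtilde H K x - H *ᵥ x) = 0 := by
    rw [mulVec_sub, hx, mulVec_mulVec, mulVec_mulVec, ← gramK, ← Matrix.mul_assoc,
      mul_nonsing_inv _ hdet, Matrix.one_mul, sub_self]
  rw [dotProduct_mulVec, ← mulVec_transpose, hz, zero_dotProduct]

lemma mulVec_xtilde_sub_sq_le {S : ℕ} (hSN : S ≤ N) {δ : ℝ}
    (hRIP : ∀ I : Finset (Fin N), I.card = S → ∀ z : ↥I → ℝ,
      (1 - δ) * ∑ i, z i ^ 2 ≤ ∑ m, ((Hsub H I).mulVec z) m ^ 2 ∧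
      ∑ m, ((Hsub H I).mulVec z) m ^ 2 ≤ (1 + δ) * ∑ i, z i ^ 2)
    (hdet : IsUnit (gramK H K).det) {x : Fin N → ℝ} (hx : x ∈ sparseSet N S) :
    (H *ᵥ xtilde H K x - H *ᵥ x) ⬝ᵥ (H *ᵥ xtilde H K x - H *ᵥ x)
      ≤ (1 + δ) * ∑ l ∈ Kᶜ, x l ^ 2 := by
  set e := H *ᵥ xtilde H K x - H *ᵥ x with he
  set z : Fin N → ℝ := fun l => if l ∈ K then 0 else x l with hz
  have hz0 : ∀ l ∉ Finset.univ.filter (fun l => x l ≠ 0), z l = 0 := by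
    intro l hl
    have : x l = 0 := by simpa using hl
    simp [hz, this]
  have hcard : (Finset.univ.filter fun l => x l ≠ 0).card ≤ S := by
    rw [← Set.ncard_coe_finset]
    simpa [sparseSet, Function.support] using hx
  have hzK : ∑ l, z l ^ 2 = ∑ l ∈ Kᶜ, x l ^ 2 := by
    rw [← Finset.sum_subset (Finset.subset_univ Kᶜ) fun l _ hl => by
      have : l ∈ K := by simpa using hl
      simp [hz, this]]
    exact Finset.sum_congr rfl fun l hl => by simp [hz, Finset.mem_compl.1 hl]
  have h := (rip_of_card_le H _ hSN hRIP hcard hz0).2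
  rw [hzK] at h
  refine le_trans ?_ h
  obtain ⟨c, hc⟩ : ∃ c : K → ℝ, e + H *ᵥ z = Hsub H K *ᵥ c := by
    refine ⟨_, Eq.trans ?_ (Hsub_mulVec_restrict H K (z := xtilde H K x - x + z) ?_).symm⟩
    · rw [mulVec_add, mulVec_sub]
    · intro l hl
      simp [xtilde, hz, hl]
  have horth : e ⬝ᵥ (e + H *ᵥ z) = 0 := by
    rw [hc]; exact mulVec_xtilde_sub_dotProduct_col H hdet x c
  have hnn : 0 ≤ (e + H *ᵥ z) ⬝ᵥ (e + H *ᵥ z) :=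
    Finset.sum_nonneg fun _ _ => mul_self_nonneg _
  simp only [add_dotProduct, dotProduct_add, dotProduct_comm (H *ᵥ z) e] at horth hnn
  linarith

lemma integral_slgmP (σ : ℝ) (x : Fin N → ℝ) {F : (Fin M → ℝ) → ℝ} (hF : Measurable F) :
    ∫ y, F y ∂slgmP H σ x
      = ∫ n, F (H *ᵥ x + n) ∂(Measure.pi fun _ : Fin M => gaussianReal 0 (σ ^ 2).toNNReal) :=
  integral_map (by fun_prop) hF.aestronglyMeasurable

end

/-- RIP-based variance bound. If `H` (with `M ≤ N`) satisfies the RIP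
of order `S` with constant `δ < 1`, then `H_KᵀH_K` is invertible and, with `x̃₀` the
vector supported on `K` with `H x̃₀ = P H x₀` and `b_l` the partial derivatives of the
mean function at `x̃₀` along `e_l`, `l ∈ K`,
`v(ĝ;x₀) ≥ exp(−((1+δ)/σ²) Σ_{l∈supp(x₀)∖K} (x₀)_l²) · σ² bᵀ(H_KᵀH_K)⁻¹ b`.
(Note `Σ_{l∈supp(x₀)∖K} (x₀)_l² = Σ_{l∉K} (x₀)_l²`, since `x₀` vanishes off its
support.) -/
theorem slgm_rip_variance_bound {N M S : ℕ} (hN : 1 ≤ N) (hM : 1 ≤ M) (hMN : M ≤ N)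
    (hS1 : 1 ≤ S) (hSN : S ≤ N)
    (H : Matrix (Fin M) (Fin N) ℝ) (σ : ℝ) (hσ : 0 < σ)
    (δ : ℝ) (hδ : δ < 1)
    (hRIP : ∀ I : Finset (Fin N), I.card = S → ∀ z : ↥I → ℝ,
      (1 - δ) * ∑ i, z i ^ 2 ≤ ∑ m, ((Hsub H I).mulVec z) m ^ 2 ∧
      ∑ m, ((Hsub H I).mulVec z) m ^ 2 ≤ (1 + δ) * ∑ i, z i ^ 2)
    (x₀ : Fin N → ℝ) (hx₀ : x₀ ∈ sparseSet N S)
    (K : Finset (Fin N)) (hKne : K.Nonempty) (hKS : K.card ≤ S)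
    (g : (Fin M → ℝ) → ℝ) (hg : Measurable g)
    (hint : ∀ x ∈ sparseSet N S, Integrable g (slgmP H σ x))
    (hsq : Integrable (fun y => g y ^ 2) (slgmP H σ x₀))
    (b : Fin N → ℝ)
    (hder : ∀ l ∈ K, HasDerivAt
      (fun t : ℝ => slgmMean H σ g (xtilde H K x₀ + t • (Pi.single l (1:ℝ) : Fin N → ℝ)))
      (b l) 0) :
    IsUnit (gramK H K).det ∧
    Real.exp (-((1 + δ) / σ ^ 2) * ∑ l ∈ Kᶜ, x₀ l ^ 2) *
        (σ ^ 2 * ∑ k : ↥K, ∑ l : ↥K, b k.1 * (gramK H K)⁻¹ k l * b l.1)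
      ≤ slgmVar H σ g x₀ := by
  have hdet := isUnit_det_gramK_s7 H hSN hδ hRIP hKS
  refine ⟨hdet, ?_⟩
  set v : ℝ≥0 := (σ ^ 2).toNNReal
  have hvσ : (v : ℝ) = σ ^ 2 := Real.coe_toNNReal _ (sq_nonneg _)
  have hv : v ≠ 0 := by
    rw [← NNReal.coe_ne_zero, hvσ]; positivity
  set π := Measure.pi fun _ : Fin M => gaussianReal 0 v
  set F : (Fin M → ℝ) → ℝ := fun n => g (H *ᵥ x₀ + n) with hFdef
  have hFm : Measurable F := hg.comp (by fun_prop)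
  have hF : MemLp F 2 π := by
    rw [memLp_two_iff_integrable_sq hFm.aestronglyMeasurable]
    exact hsq.comp_measurable (by fun_prop)
  set e := H *ᵥ xtilde H K x₀ - H *ᵥ x₀ with he
  set u : ↥K → Fin M → ℝ := fun k => Hsub H K *ᵥ Pi.single k 1 with hu
  set G := gramK H K
  set B := ∑ k : ↥K, ∑ l : ↥K, b k.1 * G⁻¹ k l * b l.1
  set b' : ↥K → ℝ := fun k => b k
  have hmean : ∀ (k : ↥K) (t : ℝ),
      slgmMean H σ g (xtilde H K x₀ + t • (Pi.single k.1 (1 : ℝ) : Fin N → ℝ))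
        = ∫ n, F n * shiftDensity v (e + t • u k) n ∂π := by
    intro k t
    rw [slgmMean, integral_slgmP H σ _ hg, ← integral_comp_add_pi_gaussianReal hv _ hFm]
    have hk : H *ᵥ (Pi.single k.1 (1 : ℝ) : Fin N → ℝ) = u k := by
      ext m; simp [hu, Hsub]
    refine integral_congr_ae (.of_forall fun n => ?_)
    simp only [hFdef, mulVec_add, mulVec_smul, hk, he]
    congr 1
    abel
  have hGram : ∀ k l, u k ⬝ᵥ u l = G k l := by
    intro k l
    simp [hu, G, gramK, Matrix.mul_apply, dotProduct]
  have hvar : slgmVar H σ g x₀ = ∫ n, (F n - slgmMean H σ g x₀) ^ 2 ∂π :=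
    integral_slgmP H σ x₀ (F := fun y => (g y - slgmMean H σ g x₀) ^ 2) (by fun_prop)
  have hB1 : b' ⬝ᵥ (G⁻¹ *ᵥ b') = B := by
    simp only [B, b', dotProduct, mulVec, Finset.mul_sum, mul_assoc]
  have hB2 : (G⁻¹ *ᵥ b') ⬝ᵥ (G *ᵥ (G⁻¹ *ᵥ b')) = B := by
    rw [mulVec_mulVec, mul_nonsing_inv _ hdet, one_mulVec, dotProduct_comm, hB1]
  set A := Real.exp (e ⬝ᵥ e / v)
  have hbound : ∀ r : ℝ, 2 * (r * B) - A * (r ^ 2 * (B / v)) ≤ slgmVar H σ g x₀ := by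
    intro r
    rw [hvar]
    refine le_trans (le_of_eq ?_) (two_mul_sum_sub_le_integral_sq hv hF (slgmMean H σ g x₀) e u
      (fun k => mulVec_xtilde_sub_dotProduct_col H hdet x₀ _) b' (r • (G⁻¹ *ᵥ b'))
      fun k => ?_)
    · congr 2
      · rw [← hB1, dotProduct_comm, ← smul_eq_mul, ← smul_dotProduct, dotProduct]
      · simp only [hGram, ← hB2]
        generalize G⁻¹ *ᵥ b' = c
        simp only [dotProduct, mulVec, Finset.mul_sum, Finset.sum_div, Pi.smul_apply,
          smul_eq_mul]
        refine Finset.sum_congr rfl fun k _ => Finset.sum_congr rfl fun l _ => ?_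
        ring
    · simpa only [hmean] using hder k k.2
  have hA : 0 < A := Real.exp_pos _
  have hB0 : 0 ≤ B := by
    rw [← hB2]
    simp only [G, gramK]
    rw [← mulVec_mulVec, dotProduct_mulVec, vecMul_transpose]
    exact Finset.sum_nonneg fun _ _ => mul_self_nonneg _
  have hopt : A⁻¹ * (σ ^ 2 * B) ≤ slgmVar H σ g x₀ := by
    refine le_trans (le_of_eq ?_) (hbound (A⁻¹ * σ ^ 2))
    rw [hvσ]
    field_simp
    ring
  refine le_trans (mul_le_mul_of_nonneg_right ?_ (by positivity)) hopt
  rw [← Real.exp_neg, Real.exp_le_exp, hvσ, neg_mul, neg_le_neg_iff, div_mul_eq_mul_div]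
  gcongr
  exact mulVec_xtilde_sub_sq_le H hSN hRIP hdet hx₀
end

section
/- (Differentiability of the mean function.) Consider the SLGM. Let ĝ : ℝ^M → ℝ be Borel measurable and P_{x'}-integrable for every x' ∈ ℝ^N. Fix x ∈ ℝ^N and l ∈ {1,…,N}. Then the function y ↦ ĝ(y)·⟨y − Hx, H e_l⟩ is P_x-integrable, and the map t ↦ ∫ ĝ dP_{x + t e_l} is differentiable at t = 0 with derivative (1/σ²) · ∫ ĝ(y) ⟨y − Hx, H e_l⟩ dP_x(y). (Equivalently: whenever the mean function γ(x) = ∫ ĝ dP_x exists everywhere, its partial derivatives exist and are given by this Gaussian-weighted integral.) -/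
open Matrix MeasureTheory ProbabilityTheory

theorem MeasureTheory.Measure.pi_withDensity {ι : Type*} [Fintype ι] {α : ι → Type*}
    [∀ i, MeasurableSpace (α i)] (μ : ∀ i, Measure (α i)) [∀ i, IsProbabilityMeasure (μ i)]
    {f : ∀ i, α i → ENNReal} (hf : ∀ i, Measurable (f i))
    [∀ i, SigmaFinite ((μ i).withDensity (f i))] :
    Measure.pi (fun i => (μ i).withDensity (f i)) =
      (Measure.pi μ).withDensity (fun y => ∏ i, f i (y i)) := by
  refine Measure.pi_eq fun s hs => ?_
  have hX : ∀ i, Measurable ((s i).indicator (f i)) := fun i => (hf i).indicator (hs i)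
  have hind : iIndepFun (fun i (y : ∀ i, α i) => (s i).indicator (f i) (y i)) (Measure.pi μ) :=
    iIndepFun_pi fun i => (hX i).aemeasurable
  have hprod : (Set.univ.pi s).indicator (fun y => ∏ i, f i (y i)) =
      fun y => ∏ i, (s i).indicator (f i) (y i) := by
    ext y
    by_cases hy : y ∈ Set.univ.pi s
    · rw [Set.indicator_of_mem hy]
      exact Finset.prod_congr rfl fun i _ => (Set.indicator_of_mem (hy i trivial) _).symm
    · rw [Set.indicator_of_notMem hy]
      simp only [Set.mem_univ_pi, not_forall] at hy
      obtain ⟨i, hi⟩ := hy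
      exact (Finset.prod_eq_zero (Finset.mem_univ i) (Set.indicator_of_notMem hi _)).symm
  rw [withDensity_apply _ (.univ_pi hs), ← lintegral_indicator (.univ_pi hs), hprod,
    lintegral_prod_eq_prod_lintegral_of_indepFun Finset.univ _ hind
      fun i => (hX i).comp (measurable_pi_apply i)]
  refine Finset.prod_congr rfl fun i _ => ?_
  rw [withDensity_apply _ (hs i), ← lintegral_indicator (hs i)]
  exact (measurePreserving_eval μ i).lintegral_comp (hX i)

theorem ProbabilityTheory.gaussianReal_add_eq_withDensity (m s : ℝ) {v : NNReal} (hv : v ≠ 0) :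
    gaussianReal (m + s) v = (gaussianReal m v).withDensity
      (fun y => ENNReal.ofReal (Real.exp (((y - m) * s - s ^ 2 / 2) / v))) := by
  have hv' : (v : ℝ) ≠ 0 := by exact_mod_cast hv
  rw [gaussianReal_of_var_ne_zero _ hv, gaussianReal_of_var_ne_zero _ hv,
    ← withDensity_mul _ (measurable_gaussianPDF m v) (by fun_prop)]
  congr 1
  ext y
  simp only [gaussianPDF, Pi.mul_apply, gaussianPDFReal_def]
  rw [← ENNReal.ofReal_mul (by positivity), mul_assoc _ (Real.exp _), ← Real.exp_add]
  congr 3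
  field_simp
  ring

theorem slgmP_eq_pi {M N : ℕ} (H : Matrix (Fin M) (Fin N) ℝ) (σ : ℝ) (x : Fin N → ℝ) :
    slgmP H σ x =
      Measure.pi (fun m => gaussianReal (H.mulVec x m) ((σ ^ 2).toNNReal)) := by
  have hmap := Measure.pi_map_pi
    (μ := fun _ : Fin M => gaussianReal 0 ((σ ^ 2).toNNReal))
    (f := fun m z => H.mulVec x m + z)
    (hμ := fun m => by rw [gaussianReal_map_const_add]; infer_instance)
    fun m => by fun_prop
  simp only [gaussianReal_map_const_add, zero_add] at hmap
  exact hmap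

theorem slgmP_add_smul_eq_withDensity {M N : ℕ} (H : Matrix (Fin M) (Fin N) ℝ) {σ : ℝ}
    (hσ : 0 < σ) (x e : Fin N → ℝ) (t : ℝ) :
    slgmP H σ (x + t • e) = (slgmP H σ x).withDensity fun y => ENNReal.ofReal
      (Real.exp (t * ((∑ m, (y m - H.mulVec x m) * H.mulVec e m) / σ ^ 2)
        - t ^ 2 * ((∑ m, H.mulVec e m ^ 2) / (2 * σ ^ 2)))) := by
  have hv : (σ ^ 2).toNNReal ≠ 0 := (Real.toNNReal_pos.2 (by positivity)).ne'
  have hvar : (((σ ^ 2).toNNReal : NNReal) : ℝ) = σ ^ 2 := Real.coe_toNNReal _ (by positivity)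
  rw [slgmP_eq_pi, slgmP_eq_pi, mulVec_add, mulVec_smul]
  simp only [Pi.add_apply, Pi.smul_apply, smul_eq_mul]
  have : ∀ m, SigmaFinite ((gaussianReal (H.mulVec x m) (σ ^ 2).toNNReal).withDensity
      fun y => ENNReal.ofReal (Real.exp (((y - H.mulVec x m) * (t * H.mulVec e m)
        - (t * H.mulVec e m) ^ 2 / 2) / ((σ ^ 2).toNNReal : NNReal)))) := fun m => by
    rw [← gaussianReal_add_eq_withDensity _ _ hv]; infer_instance
  simp only [gaussianReal_add_eq_withDensity _ _ hv]
  rw [Measure.pi_withDensity _ fun m => by fun_prop]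
  congr 1
  ext y
  rw [← ENNReal.ofReal_prod_of_nonneg fun _ _ => (Real.exp_pos _).le, ← Real.exp_sum, hvar]
  congr 2
  simp only [Finset.sum_div, Finset.mul_sum, ← Finset.sum_sub_distrib]
  refine Finset.sum_congr rfl fun m _ => ?_
  field_simp

theorem abs_mul_exp_le_exp_add_exp {t c a : ℝ} (ht : |t| ≤ 1) (hc : 0 ≤ c) :
    |a - 2 * t * c| * Real.exp (t * a - t ^ 2 * c) ≤
      (1 + 2 * c) * (Real.exp (2 * a) + Real.exp (-2 * a)) := by
  have h1 : |a - 2 * t * c| ≤ (1 + 2 * c) * Real.exp |a| := by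
    have h2 : |a - 2 * t * c| ≤ |a| + |2 * t * c| := abs_sub _ _
    have h3 : |2 * t * c| = 2 * (|t| * c) := by
      rw [abs_mul, abs_mul, abs_of_nonneg hc, abs_two]; ring
    have h4 : |t| * c ≤ c := mul_le_of_le_one_left hc ht
    have h5 := Real.add_one_le_exp |a|
    nlinarith [mul_nonneg hc (abs_nonneg a), mul_le_mul_of_nonneg_left h5 hc]
  have h2 : Real.exp (t * a - t ^ 2 * c) ≤ Real.exp |a| := by
    apply Real.exp_le_exp.2
    have h3 : t * a ≤ |t| * |a| := by rw [← abs_mul]; exact le_abs_self _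
    have h4 : |t| * |a| ≤ |a| := mul_le_of_le_one_left (abs_nonneg a) ht
    nlinarith [mul_nonneg (sq_nonneg t) hc]
  have h3 : Real.exp |a| * Real.exp |a| ≤ Real.exp (2 * a) + Real.exp (-2 * a) := by
    rw [← Real.exp_add]
    rcases abs_cases a with ⟨h, -⟩ | ⟨h, -⟩ <;> rw [h]
    · have := Real.exp_pos (-2 * a)
      rw [← two_mul]; linarith
    · have := Real.exp_pos (2 * a)
      rw [show -a + -a = -2 * a by ring]; linarith
  calc _ ≤ (1 + 2 * c) * Real.exp |a| * Real.exp |a| :=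
        mul_le_mul h1 h2 (Real.exp_pos _).le (by positivity)
    _ = (1 + 2 * c) * (Real.exp |a| * Real.exp |a|) := mul_assoc _ _ _
    _ ≤ _ := mul_le_mul_of_nonneg_left h3 (by positivity)

theorem hasDerivAt_integral_exp_mul_of_integrable {Ω : Type*} [MeasurableSpace Ω]
    {μ : Measure Ω} {g X : Ω → ℝ} (hg : Measurable g) (hX : Measurable X) {c : ℝ} (hc : 0 ≤ c)
    (hint : ∀ t : ℝ, Integrable (fun y => Real.exp (t * X y - t ^ 2 * c) * g y) μ) :
    Integrable (fun y => g y * X y) μ ∧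
      HasDerivAt (fun t : ℝ => ∫ y, Real.exp (t * X y - t ^ 2 * c) * g y ∂μ)
        (∫ y, g y * X y ∂μ) 0 := by
  have hexp : ∀ t : ℝ, Integrable (fun y => Real.exp (t * X y) * g y) μ := fun t => by
    refine ((hint t).const_mul (Real.exp (t ^ 2 * c))).congr (.of_forall fun y => ?_)
    dsimp only
    rw [← mul_assoc, ← Real.exp_add]
    congr 2
    ring
  have key := hasDerivAt_integral_of_dominated_loc_of_deriv_le (𝕜 := ℝ) (μ := μ) (x₀ := 0)
    (F := fun t y => Real.exp (t * X y - t ^ 2 * c) * g y)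
    (F' := fun t y => (X y - 2 * t * c) * Real.exp (t * X y - t ^ 2 * c) * g y)
    (bound := fun y => (1 + 2 * c) *
      (‖Real.exp (2 * X y) * g y‖ + ‖Real.exp (-2 * X y) * g y‖))
    (Metric.ball_mem_nhds 0 one_pos) (.of_forall fun t => (hint t).aestronglyMeasurable)
    (hint 0) (by fun_prop) (.of_forall fun y t ht => ?_)
    (((hexp 2).norm.add (hexp (-2)).norm).const_mul _) (.of_forall fun y t _ => ?_)
  · simpa [mul_comm] using key
  · have ht' : |t| ≤ 1 := by simpa using (mem_ball_zero_iff.1 ht).le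
    simp only [norm_mul, Real.norm_eq_abs, Real.abs_exp]
    rw [← add_mul, ← mul_assoc]
    exact mul_le_mul_of_nonneg_right (abs_mul_exp_le_exp_add_exp ht' hc) (abs_nonneg _)
  · have h : HasDerivAt (fun t : ℝ => t * X y - t ^ 2 * c) (X y - 2 * t * c) t := by
      simpa using ((hasDerivAt_id' t).mul_const (X y)).fun_sub
        ((hasDerivAt_pow 2 t).mul_const c)
    simpa [mul_comm] using h.exp.mul_const (g y)

/-- Differentiability of the mean function. If `ĝ` is Borel and
`P_{x'}`-integrable for every `x'`, then `y ↦ ĝ(y)⟨y − Hx, H e_l⟩` is `P_x`-integrable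
and `t ↦ ∫ ĝ dP_{x + t e_l}` is differentiable at `t = 0` with derivative
`(1/σ²) ∫ ĝ(y) ⟨y − Hx, H e_l⟩ dP_x(y)`. -/
theorem slgm_mean_hasDerivAt {N M : ℕ} (hN : 1 ≤ N) (hM : 1 ≤ M)
    (H : Matrix (Fin M) (Fin N) ℝ) (σ : ℝ) (hσ : 0 < σ)
    (g : (Fin M → ℝ) → ℝ) (hg : Measurable g)
    (hint : ∀ x : Fin N → ℝ, Integrable g (slgmP H σ x))
    (x : Fin N → ℝ) (l : Fin N) :
    Integrable
      (fun y => g y * ∑ m, (y m - H.mulVec x m) *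
        H.mulVec (Pi.single l (1:ℝ) : Fin N → ℝ) m) (slgmP H σ x) ∧
    HasDerivAt
      (fun t : ℝ => ∫ y, g y ∂ slgmP H σ (x + t • (Pi.single l (1:ℝ) : Fin N → ℝ)))
      ((1 / σ ^ 2) *
        ∫ y, g y * ∑ m, (y m - H.mulVec x m) *
          H.mulVec (Pi.single l (1:ℝ) : Fin N → ℝ) m ∂ slgmP H σ x)
      0 := by
  set e : Fin N → ℝ := Pi.single l 1
  set S : (Fin M → ℝ) → ℝ := fun y => ∑ m, (y m - H.mulVec x m) * H.mulVec e m with hS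
  set c : ℝ := (∑ m, H.mulVec e m ^ 2) / (2 * σ ^ 2) with hc
  have hSm : Measurable S := by fun_prop
  have hdens := slgmP_add_smul_eq_withDensity H hσ x e
  have hmeas : ∀ t : ℝ, Measurable fun y =>
      ENNReal.ofReal (Real.exp (t * (S y / σ ^ 2) - t ^ 2 * c)) := fun t => by fun_prop
  have hint' : ∀ t : ℝ, Integrable (fun y => Real.exp (t * (S y / σ ^ 2) - t ^ 2 * c) * g y)
      (slgmP H σ x) := fun t => by
    have h := hint (x + t • e)
    rw [hdens, integrable_withDensity_iff_integrable_smul' (hmeas t)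
      (.of_forall fun _ => ENNReal.ofReal_lt_top)] at h
    simpa only [ENNReal.toReal_ofReal (Real.exp_pos _).le, smul_eq_mul] using h
  have hmean : ∀ t : ℝ, ∫ y, g y ∂slgmP H σ (x + t • e) =
      ∫ y, Real.exp (t * (S y / σ ^ 2) - t ^ 2 * c) * g y ∂slgmP H σ x := fun t => by
    rw [hdens, integral_withDensity_eq_integral_toReal_smul (hmeas t)
      (.of_forall fun _ => ENNReal.ofReal_lt_top)]
    simp only [ENNReal.toReal_ofReal (Real.exp_pos _).le, smul_eq_mul, hS, hc]
  obtain ⟨hi, hd⟩ := hasDerivAt_integral_exp_mul_of_integrable hg (hSm.div_const (σ ^ 2))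
    (c := c) (by positivity) hint'
  refine ⟨(hi.const_mul (σ ^ 2)).congr (.of_forall fun y => ?_), ?_⟩
  · change σ ^ 2 * (g y * (S y / σ ^ 2)) = g y * S y
    field_simp
  · simp only [hmean]
    rw [← integral_const_mul]
    refine hd.congr_deriv (integral_congr_ae (.of_forall fun y => ?_))
    dsimp only [hS]
    ring
end
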